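/- arXiv:1303.0852 — 2 statements merged into one kernel-verified Lean document; each statement's English description precedes it below -/
import Mathlib

section
/- Let A, B, C be groups with C finite, and let ι_A : C → A and ι_B : C → B be injective group homomorphisms, neither of which is surjective. Then the center of the amalgamated free product A *_C B is a finite group. (The amalgamated-product case in the proof of Lemma 4.1: a group with infinite center cannot split as an amalgamated product over a finite subgroup that is proper in both factors.) -/
namespace Monoid.PushoutI

open CoprodI

variable {ι : Type*} {G : ι → Type*} {H : Type*} [∀ i, Group (G i)] [Group H]
  {φ : ∀ i, H →* G i}

/-- Two reduced words representing the same element of the pushout have the same sequence of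
indices. -/
theorem Reduced.map_fst_eq_of_prod_eq (hφ : ∀ i, Function.Injective (φ i)) {v w : Word G}
    (hv : Reduced φ v) (hw : Reduced φ w)
    (h : (ofCoprodI v.prod : PushoutI φ) = ofCoprodI w.prod) :
    v.toList.map Sigma.fst = w.toList.map Sigma.fst := by
  obtain ⟨d⟩ := NormalWord.transversal_nonempty φ hφ
  obtain ⟨v', hv', hv''⟩ := hv.exists_normalWord_prod_eq d
  obtain ⟨w', hw', hw''⟩ := hw.exists_normalWord_prod_eq d
  have : v' = w' := NormalWord.prod_injective (by rw [hv', hw', h])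
  rw [← hv'', ← hw'', this]

/-- Every element of an amalgamated product is the product of an element of the base and a
reduced word. -/
theorem exists_reduced (hφ : ∀ i, Function.Injective (φ i)) (x : PushoutI φ) :
    ∃ (h : H) (w : Word G), Reduced φ w ∧ x = base φ h * ofCoprodI w.prod := by
  classical
  obtain ⟨d⟩ := NormalWord.transversal_nonempty φ hφ
  obtain ⟨w, rfl⟩ := (NormalWord.equiv (d := d)).symm.surjective x
  refine ⟨w.head, w.toWord, fun ⟨i, g⟩ hg hr => ?_, rfl⟩
  have h1 := (d.compl i).equiv_snd_eq_self_iff_mem (one_mem _) |>.2 (w.normalized i g hg)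
  have h2 := (d.compl i).coe_equiv_snd_eq_one_iff_mem (d.one_mem i) |>.2 hr
  exact w.ne_one _ hg (h1.symm.trans h2)

/-- The letters of the inverse of a word are inverses of letters of the word. -/
theorem _root_.Monoid.CoprodI.NeWord.inv_mem_of_mem_toList_inv {i j : ι} (w : NeWord G i j) :
    ∀ x ∈ w.inv.toList, ⟨x.1, x.2⁻¹⟩ ∈ w.toList := by
  induction w with
  | singleton x hx => simp [NeWord.inv]
  | append w₁ hne w₂ ih₁ ih₂ =>
    intro x hx
    simp only [NeWord.inv, NeWord.toList, List.mem_append] at hx ⊢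
    exact hx.symm.imp (ih₁ x) (ih₂ x)

/-- If at least two factors are present and the base is proper in each factor, the center of an
amalgamated product is contained in the base. -/
theorem center_le_range_base [Nontrivial ι] (hφ : ∀ i, Function.Injective (φ i))
    (hφ' : ∀ i, ¬ Function.Surjective (φ i)) :
    Subgroup.center (PushoutI φ) ≤ (base φ).range := by
  intro z hz
  obtain ⟨h, w, hw, rfl⟩ := exists_reduced hφ z
  by_cases hne : w = .empty
  · exact ⟨h, by simp [hne]⟩
  exfalso
  obtain ⟨i, j, w, rfl⟩ := NeWord.of_word w hne
  obtain ⟨k, hk⟩ := exists_ne j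
  obtain ⟨b, hb⟩ := not_forall.1 (hφ' k)
  have hb' : b ∉ (φ k).range := hb
  have hmem (c : H) : φ k c ∈ (φ k).range := ⟨c, rfl⟩
  have hconj : (φ k h)⁻¹ * b * φ k h ∉ (φ k).range := by
    rwa [Subgroup.mul_mem_cancel_right _ (hmem h),
      Subgroup.mul_mem_cancel_left _ (inv_mem (hmem h))]
  have hone {g : G k} (hg : g ∉ (φ k).range) : g ≠ 1 := fun e => hg (e ▸ one_mem _)
  let u : NeWord G i i :=
    (w.append hk.symm (.singleton b (hone hb'))).append hk w.inv
  let v : NeWord G k k := .singleton _ (hone hconj)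
  have hu : Reduced φ u.toWord := by
    intro x hx
    replace hx : x ∈ (w.toList ++ [⟨k, b⟩]) ++ w.inv.toList := hx
    simp only [List.mem_append, List.mem_singleton] at hx
    obtain (hx | rfl) | hx := hx
    · exact hw x hx
    · exact hb'
    · have := hw _ (w.inv_mem_of_mem_toList_inv x hx)
      simpa using this
  have hv : Reduced φ v.toWord := by
    intro x hx
    replace hx : x ∈ [(⟨k, _⟩ : Σ i, G i)] := hx
    obtain rfl := List.mem_singleton.1 hx
    exact hconj
  have hprod : (ofCoprodI u.prod : PushoutI φ) = ofCoprodI v.prod := by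
    have := Subgroup.mem_center_iff.1 hz (of k b)
    simp only [u, v, NeWord.append_prod, NeWord.inv_prod, NeWord.prod_singleton, map_mul, map_inv,
      ofCoprodI_of, of_apply_eq_base]
    rw [mul_inv_eq_iff_eq_mul]
    change _ * (_ * ofCoprodI w.prod) = _ * ofCoprodI w.prod * _ at this
    simp only [mul_assoc] at this ⊢
    rw [this, inv_mul_cancel_left]
  have hlen := congrArg List.length (hu.map_fst_eq_of_prod_eq hφ hv hprod)
  simp only [u, v, NeWord.toWord, NeWord.toList, List.length_map, List.length_append,
    List.length_singleton] at hlen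
  exact w.toList_ne_nil (List.length_eq_zero_iff.1 (by lia))

end Monoid.PushoutI


/-- The amalgamated-product case in the proof of Lemma 4.1: if `C` is finite and
embeds as a proper subgroup in both `A` and `B`, then the center of the
amalgamated free product `A *_C B` is a finite group.  Here the amalgamated
product is formalized as `Monoid.PushoutI` over the index type `Bool`, with
`G true = A` and `G false = B`. -/
theorem center_finite_of_pushout_of_finite_base
    {C : Type*} [Group C] [Finite C] {G : Bool → Type*} [∀ b, Group (G b)]
    (φ : ∀ b, C →* G b)
    (hinj : ∀ b, Function.Injective (φ b))
    (hnsurj : ∀ b, ¬ Function.Surjective (φ b)) :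
    Finite (Subgroup.center (Monoid.PushoutI φ)) := by
  have : Finite (Monoid.PushoutI.base φ).range :=
    Set.finite_range (Monoid.PushoutI.base φ)
  exact Finite.of_injective _
    (Subgroup.inclusion_injective (Monoid.PushoutI.center_le_range_base hinj hnsurj))
end

section
/- Let G be a group, let A be a finite subgroup of G, let B be a subgroup of G, and let φ : A ≃* B be an isomorphism. If the center of the HNN extension HNNExtension G A B φ is infinite, then A = ⊤ and B = ⊤; in particular, G = A is a finite group. (The algebraic core of Lemma 4.1: a group with infinite center that splits as an HNN extension over a finite subgroup must be an HNN extension of a finite group over the whole group.) -/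
namespace HNNExtension

open NormalWord

variable {G : Type*} [Group G] {A B : Subgroup G} (φ : A ≃* B)

theorem exists_reducedWord_prod_eq (x : HNNExtension G A B φ) :
    ∃ w : ReducedWord G A B, w.prod φ = x := by
  obtain ⟨d⟩ := TransversalPair.nonempty G A B
  exact ⟨((NormalWord.equiv φ d) x).toReducedWord, (NormalWord.equiv φ d).symm_apply_apply x⟩

/-- Right multiplication by an element of the base group changes only the last letter of a
reduced word that contains the stable letter. -/
theorem ReducedWord.exists_prod_eq_mul_of (w : ReducedWord G A B) (hw : w.toList ≠ []) (g : G) :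
    ∃ w' : ReducedWord G A B, w'.head = w.head ∧ w'.prod φ = w.prod φ * of g := by
  obtain ⟨h, l, hl⟩ := w
  obtain rfl | ⟨l, ⟨u, x⟩, rfl⟩ := List.eq_nil_or_concat' l
  · exact absurd rfl hw
  · refine ⟨⟨h, l ++ [(u, x * g)], ?_⟩, rfl, by simp [ReducedWord.prod, mul_assoc]⟩
    rw [List.isChain_append] at hl ⊢
    exact ⟨hl.1, by simp, by simpa using hl.2.2⟩

theorem mem_of_commute_t {g : G} (h : Commute (t : HNNExtension G A B φ) (of g)) : g ∈ A := by
  by_contra hg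
  let w : ReducedWord G A B := ⟨1, [(1, g), (-1, 1)], by simp [hg]⟩
  have hw : w.prod φ = of g := by
    simp [w, ReducedWord.prod, h.eq]
  simpa [w] using ReducedWord.toList_eq_nil_of_mem_of_range φ w ⟨g, hw.symm⟩

/-- If a reduced word containing the stable letter represents a central element, then one of the
associated subgroups is the whole base group. -/
theorem eq_top_or_eq_top_of_prod_mem_center (w : ReducedWord G A B) (hw : w.toList ≠ [])
    (hz : w.prod φ ∈ Subgroup.center (HNNExtension G A B φ)) : A = ⊤ ∨ B = ⊤ := by
  obtain ⟨⟨u, x⟩, l, hl⟩ := List.exists_cons_of_ne_nil hw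
  have key : toSubgroup A B (-u) = ⊤ := by
    refine (Subgroup.eq_top_iff' _).2 fun k => ?_
    obtain ⟨w', hhead, hprod⟩ :=
      ReducedWord.exists_prod_eq_mul_of φ w hw (w.head * k * w.head⁻¹)
    let v : ReducedWord G A B := ⟨w.head * k * w.head⁻¹ * w.head, w.toList, w.chain⟩
    have hv : w'.prod φ = v.prod φ := by
      rw [hprod, ← Subgroup.mem_center_iff.1 hz]
      simp [v, ReducedWord.prod, mul_assoc]
    have := (ReducedWord.map_fst_eq_and_of_prod_eq φ hv.symm).2 u (by simp [v, hl])
    simpa [v, hhead] using this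
  rcases Int.units_eq_one_or u with rfl | rfl
  · exact .inr key
  · exact .inl (by simpa using key)

end HNNExtension


/-- The algebraic core of Lemma 4.1: if `A` is a finite subgroup of `G`,
`φ : A ≃* B`, and the HNN extension `HNNExtension G A B φ` has infinite center,
then `A = ⊤` and `B = ⊤`; in particular `G = A` is a finite group. -/
theorem hnnExtension_infinite_center_top
    {G : Type*} [Group G] (A B : Subgroup G) [Finite A] (φ : A ≃* B)
    (h : Infinite (Subgroup.center (HNNExtension G A B φ))) :
    A = ⊤ ∧ B = ⊤ ∧ Finite G := by
 
  have hB : Finite B := Finite.of_equiv A φ.toEquiv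
  have htop : A = ⊤ ∨ B = ⊤ := by
    by_contra hne
    have hle : Subgroup.center (HNNExtension G A B φ) ≤ A.map HNNExtension.of := by
      intro z hz
      obtain ⟨w, rfl⟩ := HNNExtension.exists_reducedWord_prod_eq φ z
      have hnil : w.toList = [] := by
        by_contra hw
        exact hne (HNNExtension.eq_top_or_eq_top_of_prod_mem_center φ w hw hz)
      have hw : w.prod φ = HNNExtension.of w.head := by
        simp [HNNExtension.NormalWord.ReducedWord.prod, hnil]
      rw [hw] at hz ⊢
      exact Subgroup.mem_map_of_mem _
        (HNNExtension.mem_of_commute_t φ (Subgroup.mem_center_iff.1 hz _))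
    have : Finite (A.map (HNNExtension.of (φ := φ))) :=
      ((A : Set G).toFinite.image _).to_subtype
    exact h.not_finite (Finite.of_injective _ (Subgroup.inclusion_injective hle))
  have hG : Finite G := by
    rcases htop with rfl | rfl
    · exact Finite.of_equiv _ Subgroup.topEquiv.toEquiv
    · exact Finite.of_equiv _ Subgroup.topEquiv.toEquiv
  have hcard : Nat.card A = Nat.card B := Nat.card_congr φ.toEquiv
  rcases htop with hA | hB
  · exact ⟨hA, Subgroup.eq_top_of_card_eq _ (by rw [← hcard, hA, Subgroup.card_top]), hG⟩
  · exact ⟨Subgroup.eq_top_of_card_eq _ (by rw [hcard, hB, Subgroup.card_top]), hB, hG⟩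
end
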